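/- Let P = [[U⁻¹, −K],[−Kᵀ, V⁻¹]] be the symmetric block matrix of the positive-definiteness lemma with blocks K_j, U = u I, V_j = v_j I, and suppose there exists ε > 0 with (J+ε)(1+ε)‖U^{1/2} K_j V_j^{1/2}‖₂² ≤ 1 for every j. Then for all x ∈ ℝ^d and y = (y₁,…,y_J): ⟨(x,y), P(x,y)⟩ ≥ (ε/(J+ε))⟨x, U⁻¹x⟩ + (ε/(1+ε))Σ_j ⟨y_j, V_j⁻¹ y_j⟩. -/

import Mathlib

open Matrix

/-- Spectral norm (largest singular value) of a real matrix. -/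
noncomputable def specNorm {d m : ℕ} (A : Matrix (Fin d) (Fin m) ℝ) : ℝ :=
  ‖LinearMap.toContinuousLinearMap (Matrix.toEuclideanLin A)‖

theorem dot_le_specNorm {d m : ℕ} (A : Matrix (Fin d) (Fin m) ℝ) (x : Fin d → ℝ)
    (y : Fin m → ℝ) :
    x ⬝ᵥ A.mulVec y ≤ specNorm A * ‖WithLp.toLp 2 x‖ * ‖WithLp.toLp 2 y‖ := by
  have h1 := real_inner_le_norm (WithLp.toLp 2 x : EuclideanSpace ℝ (Fin d))
    (Matrix.toEuclideanLin A (WithLp.toLp 2 y))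
  have h2 := (LinearMap.toContinuousLinearMap (Matrix.toEuclideanLin A)).le_opNorm (WithLp.toLp 2 y)
  have h3 : inner ℝ (WithLp.toLp 2 x : EuclideanSpace ℝ (Fin d))
    (Matrix.toEuclideanLin A (WithLp.toLp 2 y)) = x ⬝ᵥ A.mulVec y := by
    simp [EuclideanSpace.inner_eq_star_dotProduct, dotProduct_comm]
  rw [h3] at h1
  have h4 : ‖Matrix.toEuclideanLin A (WithLp.toLp 2 y)‖ ≤ specNorm A * ‖WithLp.toLp 2 y‖ := h2
  calc _ ≤ _ := h1
    _ ≤ ‖WithLp.toLp 2 x‖ * (specNorm A * ‖WithLp.toLp 2 y‖) := by gcongr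
    _ = _ := by ring

theorem norm_toLp_sq {m : ℕ} (y : Fin m → ℝ) : ‖WithLp.toLp 2 y‖ ^ 2 = ∑ a, y a ^ 2 := by
  simp [EuclideanSpace.norm_sq_eq]

theorem young_aux (p q s a b : ℝ) (hp : 0 < p) (hq : 0 < q) (h : p * q * s ^ 2 ≤ 1) :
    2 * (s * a * b) ≤ 1 / p * a ^ 2 + 1 / q * b ^ 2 := by
  have h0 : 0 ≤ (a - p * s * b) ^ 2 := sq_nonneg _
  have h1 : 1 / p * a ^ 2 + 1 / q * b ^ 2 - 2 * (s * a * b)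
      = 1 / p * (a - p * s * b) ^ 2 + 1 / q * (1 - p * q * s ^ 2) * b ^ 2 := by
    field_simp
    ring
  have h2 : 0 ≤ 1 / p * (a - p * s * b) ^ 2 := by positivity
  have h3 : 0 ≤ 1 / q * (1 - p * q * s ^ 2) * b ^ 2 := by
    have : 0 ≤ 1 - p * q * s ^ 2 := by linarith
    positivity
  linarith

theorem cross_aux {d m : ℕ} (B : Matrix (Fin d) (Fin m) ℝ) (u v p q : ℝ) (hu : 0 < u)
    (hv : 0 < v) (hp : 0 < p) (hq : 0 < q)
    (h : p * q * (specNorm ((Real.sqrt u • (1 : Matrix (Fin d) (Fin d) ℝ)) * B *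
          (Real.sqrt v • (1 : Matrix (Fin m) (Fin m) ℝ)))) ^ 2 ≤ 1)
    (x : Fin d → ℝ) (y : Fin m → ℝ) :
    2 * (x ⬝ᵥ B.mulVec y) ≤ 1 / p * (u⁻¹ * (x ⬝ᵥ x)) + 1 / q * (v⁻¹ * ∑ a, y a ^ 2) := by
  have hsu := Real.sqrt_pos.2 hu
  have hsv := Real.sqrt_pos.2 hv
  have h1 := dot_le_specNorm ((Real.sqrt u • (1 : Matrix (Fin d) (Fin d) ℝ)) * B *
          (Real.sqrt v • (1 : Matrix (Fin m) (Fin m) ℝ))) ((Real.sqrt u)⁻¹ • x) ((Real.sqrt v)⁻¹ • y)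
  have h2 := young_aux p q _ ‖WithLp.toLp 2 ((Real.sqrt u)⁻¹ • x)‖
    ‖WithLp.toLp 2 ((Real.sqrt v)⁻¹ • y)‖ hp hq h
  rw [norm_toLp_sq, norm_toLp_sq] at h2
  have h3 : ((Real.sqrt u)⁻¹ • x) ⬝ᵥ ((Real.sqrt u • (1 : Matrix (Fin d) (Fin d) ℝ)) * B *
          (Real.sqrt v • (1 : Matrix (Fin m) (Fin m) ℝ))).mulVec ((Real.sqrt v)⁻¹ • y)
      = x ⬝ᵥ B.mulVec y := by
    simp only [Matrix.smul_mul, Matrix.mul_smul, Matrix.one_mul, Matrix.mul_one,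
      Matrix.smul_mulVec, Matrix.mulVec_smul, smul_dotProduct, dotProduct_smul, smul_eq_mul]
    field_simp
  have h4 : ∑ a, ((Real.sqrt u)⁻¹ • x) a ^ 2 = u⁻¹ * (x ⬝ᵥ x) := by
    simp only [Pi.smul_apply, smul_eq_mul, mul_pow, inv_pow, Real.sq_sqrt hu.le, dotProduct,
      Finset.mul_sum, ← sq]
  have h5 : ∑ a, ((Real.sqrt v)⁻¹ • y) a ^ 2 = v⁻¹ * ∑ a, y a ^ 2 := by
    simp only [Pi.smul_apply, smul_eq_mul, mul_pow, inv_pow, Real.sq_sqrt hv.le, Finset.mul_sum]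
  rw [h3] at h1
  rw [h4, h5] at h2
  linarith

theorem quantitative_block_posDef
    (d J : ℕ) (hJ : 0 < J) (mSize : Fin J → ℕ)
    (K : Matrix (Fin d) ((j : Fin J) × Fin (mSize j)) ℝ)
    (Kb : (j : Fin J) → Matrix (Fin d) (Fin (mSize j)) ℝ)
    (hKb : ∀ j a i, Kb j i a = K i ⟨j, a⟩)
    (u : ℝ) (hu : 0 < u) (v : Fin J → ℝ) (hv : ∀ j, 0 < v j)
    (ε : ℝ) (hε : 0 < ε)
    (hblock : ∀ j, ((J : ℝ) + ε) * (1 + ε) *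
        (specNorm ((Real.sqrt u • (1 : Matrix (Fin d) (Fin d) ℝ)) * Kb j *
          (Real.sqrt (v j) • (1 : Matrix (Fin (mSize j)) (Fin (mSize j)) ℝ)))) ^ 2 ≤ 1) :
    ∀ (x : Fin d → ℝ) (y : ((j : Fin J) × Fin (mSize j)) → ℝ),
      (Sum.elim x y) ⬝ᵥ
          (Matrix.fromBlocks (u⁻¹ • (1 : Matrix (Fin d) (Fin d) ℝ)) (-K) (-Kᵀ)
            (Matrix.diagonal fun p => (v p.1)⁻¹)).mulVec (Sum.elim x y)
        ≥ ε / ((J : ℝ) + ε) * (u⁻¹ * (x ⬝ᵥ x))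
          + ε / (1 + ε) * ∑ j, (v j)⁻¹ * ∑ a, (y ⟨j, a⟩) ^ 2 := by
  intro x y
  have hJ' : (0 : ℝ) < J := by exact_mod_cast hJ
  have hc : ∀ j, 2 * (x ⬝ᵥ (Kb j).mulVec fun a => y ⟨j, a⟩) ≤
      1 / ((J : ℝ) + ε) * (u⁻¹ * (x ⬝ᵥ x)) + 1 / (1 + ε) * ((v j)⁻¹ * ∑ a, y ⟨j, a⟩ ^ 2) :=
    fun j => cross_aux (Kb j) u (v j) _ _ hu (hv j) (by positivity) (by positivity) (hblock j) x _
  have hs := Finset.sum_le_sum fun j (_ : j ∈ Finset.univ) => hc j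
  rw [← Finset.mul_sum, Finset.sum_add_distrib, Finset.sum_const,
    Finset.card_univ, Fintype.card_fin, nsmul_eq_mul,
    ← Finset.mul_sum Finset.univ (fun j => (v j)⁻¹ * ∑ a, y ⟨j, a⟩ ^ 2)] at hs
  have hK : x ⬝ᵥ K.mulVec y = ∑ j, x ⬝ᵥ (Kb j).mulVec fun a => y ⟨j, a⟩ := by
    simp only [dotProduct, Matrix.mulVec, hKb, Fintype.sum_sigma, Finset.mul_sum]
    rw [Finset.sum_comm]
  have hD : y ⬝ᵥ (Matrix.diagonal fun p : (j : Fin J) × Fin (mSize j) => (v p.1)⁻¹).mulVec y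
      = ∑ j, (v j)⁻¹ * ∑ a, (y ⟨j, a⟩) ^ 2 := by
    simp only [dotProduct, Matrix.mulVec_diagonal, Fintype.sum_sigma, Finset.mul_sum]
    refine Finset.sum_congr rfl fun j _ => Finset.sum_congr rfl fun a _ => by ring
  have hT : y ⬝ᵥ Kᵀ.mulVec x = x ⬝ᵥ K.mulVec y := by
    rw [Matrix.mulVec_transpose, dotProduct_comm, Matrix.dotProduct_mulVec]
  have hL : (Sum.elim x y) ⬝ᵥ
          (Matrix.fromBlocks (u⁻¹ • (1 : Matrix (Fin d) (Fin d) ℝ)) (-K) (-Kᵀ)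
            (Matrix.diagonal fun p => (v p.1)⁻¹)).mulVec (Sum.elim x y)
      = u⁻¹ * (x ⬝ᵥ x) - 2 * (x ⬝ᵥ K.mulVec y) + ∑ j, (v j)⁻¹ * ∑ a, (y ⟨j, a⟩) ^ 2 := by
    rw [Matrix.fromBlocks_mulVec, sumElim_dotProduct_sumElim]
    simp only [Sum.elim_comp_inl, Sum.elim_comp_inr, dotProduct_add, Matrix.neg_mulVec,
      dotProduct_neg, Matrix.smul_mulVec, Matrix.one_mulVec, dotProduct_smul, smul_eq_mul, hT, hD]
    ring
  rw [hL, hK]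
  have e1 : ε / ((J : ℝ) + ε) = 1 - J * (1 / ((J : ℝ) + ε)) := by
    field_simp
    ring
  have e2 : ε / (1 + ε) = 1 - 1 / (1 + ε) := by
    field_simp
    ring
  rw [e1, e2]
  linarith
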